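/- Let A_i, B_i, C_i, D_i, E_i, F_i (i = 1,…,4) and C_c be quaternion matrices of conformable sizes, and suppose A_iD_i = C_iB_i for i = 2, 3, 4, R_{A_i}C_i = 0 and D_iL_{B_i} = 0 for i = 1, 2, 3, 4. Set A_{ii} := E_iL_{A_i}, B_{ii} := R_{B_i}F_i (i = 1,…,4) and T₁ := C_c − E₁A₁†C₁ − D₁B₁†F₁ − Σ_{i=2}^{4} E_i(A_i†C_i + L_{A_i}D_iB_i†)F_i. Then the system A₁U = C₁, VB₁ = D₁, A₂X = C₂, XB₂ = D₂, A₃Y = C₃, YB₃ = D₃, A₄Z = C₄, ZB₄ = D₄, E₁U + VF₁ + E₂XF₂ + E₃YF₃ + E₄ZF₄ = C_c has a solution (U, V, X, Y, Z) if and only if the equation A₁₁S₁ + S₂B₁₁ + A₂₂U₁B₂₂ + A₃₃U₂B₃₃ + A₄₄U₃B₄₄ = T₁ has a solution (S₁, S₂, U₁, U₂, U₃). -/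

import Mathlib

open scoped Quaternion Classical
open Matrix

noncomputable section

/-- The four Moore–Penrose conditions for `X` to be the Moore–Penrose inverse of `A`
over the real quaternions. -/
def IsMP {m n : Type*} [Fintype m] [Fintype n]
    (A : Matrix m n ℍ[ℝ]) (X : Matrix n m ℍ[ℝ]) : Prop :=
  A * X * A = A ∧ X * A * X = X ∧ (A * X)ᴴ = A * X ∧ (X * A)ᴴ = X * A

/-- The Moore–Penrose inverse `A†` of a quaternion matrix (it exists and is unique). -/
def dg {m n : Type*} [Fintype m] [Fintype n]
    (A : Matrix m n ℍ[ℝ]) : Matrix n m ℍ[ℝ] :=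
  if h : ∃ X, IsMP A X then h.choose else 0

/-- `L_A = I - A† A`. -/
def lproj {m n : Type*} [Fintype m] [Fintype n] [DecidableEq n]
    (A : Matrix m n ℍ[ℝ]) : Matrix n n ℍ[ℝ] :=
  1 - dg A * A

/-- `R_A = I - A A†`. -/
def rproj {m n : Type*} [Fintype m] [Fintype n] [DecidableEq m]
    (A : Matrix m n ℍ[ℝ]) : Matrix m m ℍ[ℝ] :=
  1 - A * dg A

section InnerInverse

theorem exists_linearMap_comp_comp_eq {K V W : Type*} [DivisionRing K] [AddCommGroup V]
    [Module K V] [AddCommGroup W] [Module K W] (f : V →ₗ[K] W) :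
    ∃ g : W →ₗ[K] V, f ∘ₗ g ∘ₗ f = f := by
  obtain ⟨s, hs⟩ := f.rangeRestrict.exists_rightInverse_of_surjective f.range_rangeRestrict
  obtain ⟨g, hg⟩ := LinearMap.exists_extend s
  refine ⟨g, LinearMap.ext fun x => ?_⟩
  have h₁ : g (f x) = s (f.rangeRestrict x) := LinearMap.congr_fun hg (f.rangeRestrict x)
  have h₂ : f.rangeRestrict (s (f.rangeRestrict x)) = f.rangeRestrict x :=
    LinearMap.congr_fun hs (f.rangeRestrict x)
  simpa [h₁] using congrArg Subtype.val h₂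

theorem exists_matrix_mul_mul_eq {K m n : Type*} [DivisionRing K] [Fintype m] [Fintype n]
    (A : Matrix m n K) : ∃ G : Matrix n m K, A * G * A = A := by
  obtain ⟨g, hg⟩ := exists_linearMap_comp_comp_eq (Matrix.toLinearMapRight' A)
  refine ⟨LinearMap.toMatrixRight' g, Matrix.toLinearMapRight'.injective ?_⟩
  rw [Matrix.toLinearMapRight'_mul, Matrix.toLinearMapRight'_mul]
  simpa using hg

end InnerInverse

section MoorePenrose

variable {m n k l : Type*} [Fintype m] [Fintype n] [Fintype k] [Fintype l]

theorem quaternion_conjTranspose_mul_self_eq_zero {o : Type*} {M : Matrix m o ℍ[ℝ]}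
    (h : Mᴴ * M = 0) : M = 0 := by
  ext1 i j
  have hj : ∑ a, star (M a j) * M a j = 0 := by
    simpa [Matrix.mul_apply] using congrFun (congrFun h j) j
  have hs : ∑ a, Quaternion.normSq (M a j) = 0 := by
    refine (map_eq_zero (algebraMap ℝ ℍ[ℝ])).1 ?_
    rw [map_sum, ← hj]
    simp only [Quaternion.star_mul_self]
    rfl
  rw [Finset.sum_eq_zero_iff_of_nonneg fun a _ => Quaternion.normSq_nonneg] at hs
  exact Quaternion.normSq_eq_zero.1 (hs i (Finset.mem_univ i))

theorem exists_mul_conjTranspose_mul_self_eq (A : Matrix m n ℍ[ℝ]) :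
    ∃ G : Matrix n n ℍ[ℝ], A * G * Aᴴ * A = A := by
  obtain ⟨G, hG⟩ := exists_matrix_mul_mul_eq (Aᴴ * A)
  refine ⟨G, sub_eq_zero.1 (quaternion_conjTranspose_mul_self_eq_zero ?_)⟩
  have h : Aᴴ * (A * G * Aᴴ * A - A) = 0 := by
    rw [Matrix.mul_sub, sub_eq_zero]
    simpa only [Matrix.mul_assoc] using hG
  have h' : A * G * Aᴴ * A - A = A * (G * Aᴴ * A - 1) := by
    simp only [Matrix.mul_sub, Matrix.mul_assoc, Matrix.mul_one]
  calc (A * G * Aᴴ * A - A)ᴴ * (A * G * Aᴴ * A - A)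
      = (A * (G * Aᴴ * A - 1))ᴴ * (A * G * Aᴴ * A - A) := by rw [← h']
    _ = 0 := by rw [Matrix.conjTranspose_mul, Matrix.mul_assoc, h, Matrix.mul_zero]

/-- Every quaternion matrix has an inner inverse `X` for which `A * X` is Hermitian. -/
theorem exists_inner_inverse_hermitian_left (A : Matrix m n ℍ[ℝ]) :
    ∃ X : Matrix n m ℍ[ℝ], A * X * A = A ∧ (A * X)ᴴ = A * X := by
  obtain ⟨G, hG⟩ := exists_mul_conjTranspose_mul_self_eq A
  have hG' : Aᴴ * A * Gᴴ * Aᴴ = Aᴴ := by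
    simpa [Matrix.conjTranspose_mul, Matrix.mul_assoc] using congrArg Matrix.conjTranspose hG
  have key : A * (G * Aᴴ) = A * G * (Aᴴ * A * Gᴴ * Aᴴ) := by rw [hG', Matrix.mul_assoc]
  refine ⟨G * Aᴴ, by simpa only [Matrix.mul_assoc] using hG, ?_⟩
  rw [key]
  simp only [Matrix.conjTranspose_mul, Matrix.conjTranspose_conjTranspose, Matrix.mul_assoc]

theorem exists_inner_inverse_hermitian_right (A : Matrix m n ℍ[ℝ]) :
    ∃ Y : Matrix n m ℍ[ℝ], A * Y * A = A ∧ (Y * A)ᴴ = Y * A := by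
  obtain ⟨X, h₁, h₂⟩ := exists_inner_inverse_hermitian_left Aᴴ
  have h₃ : Xᴴ * A = Aᴴ * X := by
    simpa [Matrix.conjTranspose_mul] using h₂
  refine ⟨Xᴴ, ?_, ?_⟩
  · simpa [Matrix.conjTranspose_mul, Matrix.mul_assoc] using congrArg Matrix.conjTranspose h₁
  · rw [h₃, h₂]

theorem exists_isMP (A : Matrix m n ℍ[ℝ]) : ∃ X, IsMP A X := by
  obtain ⟨X, hX, hX'⟩ := exists_inner_inverse_hermitian_left A
  obtain ⟨Y, hY, hY'⟩ := exists_inner_inverse_hermitian_right A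
  have hl : A * (Y * A * X) = A * X := by
    rw [← Matrix.mul_assoc, ← Matrix.mul_assoc, hY]
  have hr : Y * A * X * A = Y * A := by
    rw [Matrix.mul_assoc Y, Matrix.mul_assoc, hX]
  refine ⟨Y * A * X, ?_, ?_, ?_, ?_⟩
  · rw [hl, hX]
  · rw [hr, Matrix.mul_assoc Y A, hl]
    simp only [Matrix.mul_assoc]
  · rw [hl, hX']
  · rw [hr, hY']

theorem mul_dg_mul (A : Matrix m n ℍ[ℝ]) : A * dg A * A = A := by
  rw [dg, dif_pos (exists_isMP A)]
  exact (exists_isMP A).choose_spec.1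

theorem mul_lproj [DecidableEq n] (A : Matrix m n ℍ[ℝ]) : A * lproj A = 0 := by
  rw [lproj, Matrix.mul_sub, Matrix.mul_one, ← Matrix.mul_assoc, mul_dg_mul, sub_self]

theorem rproj_mul [DecidableEq m] (A : Matrix m n ℍ[ℝ]) : rproj A * A = 0 := by
  rw [rproj, Matrix.sub_mul, Matrix.one_mul, mul_dg_mul, sub_self]

theorem mul_dg_mul_of_rproj_mul {o : Type*} [DecidableEq m] {A : Matrix m n ℍ[ℝ]}
    {C : Matrix m o ℍ[ℝ]}
    (h : rproj A * C = 0) : A * dg A * C = C := by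
  rw [rproj, Matrix.sub_mul, Matrix.one_mul, sub_eq_zero] at h
  exact h.symm

theorem mul_dg_mul_of_mul_lproj {o : Type*} [DecidableEq l] {B : Matrix k l ℍ[ℝ]}
    {D : Matrix o l ℍ[ℝ]}
    (h : D * lproj B = 0) : D * dg B * B = D := by
  rw [lproj, Matrix.mul_sub, Matrix.mul_one, sub_eq_zero, ← Matrix.mul_assoc] at h
  exact h.symm

theorem mul_left_solution {o : Type*} [DecidableEq m] [DecidableEq n] {A : Matrix m n ℍ[ℝ]}
    {C : Matrix m o ℍ[ℝ]} (h : rproj A * C = 0) (W : Matrix n o ℍ[ℝ]) :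
    A * (dg A * C + lproj A * W) = C := by
  rw [Matrix.mul_add, ← Matrix.mul_assoc, ← Matrix.mul_assoc, mul_dg_mul_of_rproj_mul h,
    mul_lproj, Matrix.zero_mul, add_zero]

theorem mul_right_solution {o : Type*} [DecidableEq k] [DecidableEq l] {B : Matrix k l ℍ[ℝ]}
    {D : Matrix o l ℍ[ℝ]} (h : D * lproj B = 0) (W : Matrix o k ℍ[ℝ]) :
    (D * dg B + W * rproj B) * B = D := by
  rw [Matrix.add_mul, mul_dg_mul_of_mul_lproj h, Matrix.mul_assoc, rproj_mul, Matrix.mul_zero,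
    add_zero]

theorem mul_left_common_solution [DecidableEq m] [DecidableEq n] [DecidableEq k]
    {A : Matrix m n ℍ[ℝ]} {B : Matrix k l ℍ[ℝ]} {C : Matrix m k ℍ[ℝ]}
    (D : Matrix n l ℍ[ℝ]) (hA : rproj A * C = 0) (W : Matrix n k ℍ[ℝ]) :
    A * (dg A * C + lproj A * D * dg B + lproj A * W * rproj B) = C := by
  have h := mul_left_solution hA (D * dg B + W * rproj B)
  simpa only [Matrix.mul_add, Matrix.mul_assoc, add_assoc] using h

theorem mul_right_common_solution [DecidableEq n] [DecidableEq k] [DecidableEq l]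
    {A : Matrix m n ℍ[ℝ]} {B : Matrix k l ℍ[ℝ]} {C : Matrix m k ℍ[ℝ]} {D : Matrix n l ℍ[ℝ]}
    (h : A * D = C * B) (hB : D * lproj B = 0) (W : Matrix n k ℍ[ℝ]) :
    (dg A * C + lproj A * D * dg B + lproj A * W * rproj B) * B = D := by
  have h₁ : dg A * C * B = dg A * A * D := by rw [Matrix.mul_assoc, ← h, Matrix.mul_assoc]
  have h₂ : lproj A * D * dg B * B = lproj A * D := by
    rw [Matrix.mul_assoc (lproj A), Matrix.mul_assoc, mul_dg_mul_of_mul_lproj hB]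
  rw [Matrix.add_mul, Matrix.add_mul, h₁, h₂, Matrix.mul_assoc _ (rproj B), rproj_mul,
    Matrix.mul_zero, add_zero, lproj, Matrix.sub_mul, Matrix.one_mul, add_sub_cancel]

theorem eq_add_lproj_mul {o : Type*} [DecidableEq n] {A : Matrix m n ℍ[ℝ]}
    {C : Matrix m o ℍ[ℝ]}
    {U : Matrix n o ℍ[ℝ]} (h : A * U = C) : U = dg A * C + lproj A * U := by
  rw [lproj, Matrix.sub_mul, Matrix.one_mul, Matrix.mul_assoc, h, add_sub_cancel]

theorem eq_add_mul_rproj {o : Type*} [DecidableEq k] {B : Matrix k l ℍ[ℝ]}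
    {D : Matrix o l ℍ[ℝ]}
    {V : Matrix o k ℍ[ℝ]} (h : V * B = D) : V = D * dg B + V * rproj B := by
  rw [rproj, Matrix.mul_sub, Matrix.mul_one, ← Matrix.mul_assoc, h, add_sub_cancel]

theorem eq_add_lproj_mul_rproj [DecidableEq n] [DecidableEq k] {A : Matrix m n ℍ[ℝ]}
    {B : Matrix k l ℍ[ℝ]} {C : Matrix m k ℍ[ℝ]} {D : Matrix n l ℍ[ℝ]} {X : Matrix n k ℍ[ℝ]}
    (hA : A * X = C) (hB : X * B = D) :
    X = dg A * C + lproj A * D * dg B + lproj A * X * rproj B := by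
  rw [add_assoc, Matrix.mul_assoc, Matrix.mul_assoc, ← Matrix.mul_add, ← eq_add_mul_rproj hB]
  exact eq_add_lproj_mul hA

end MoorePenrose

/-- Under the stated consistency conditions for the eight linear equations,
the full system is solvable iff the reduced five-term Sylvester equation is solvable. -/
theorem quat_main_system_solvable_iff_reduced_solvable
    {p q m₁ n₁ r₁ s₁ m₂ n₂ r₂ s₂ m₃ n₃ r₃ s₃ m₄ n₄ r₄ s₄ : ℕ}
    (A₁ : Matrix (Fin m₁) (Fin n₁) ℍ[ℝ]) (B₁ : Matrix (Fin r₁) (Fin s₁) ℍ[ℝ])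
    (C₁ : Matrix (Fin m₁) (Fin q) ℍ[ℝ]) (D₁ : Matrix (Fin p) (Fin s₁) ℍ[ℝ])
    (A₂ : Matrix (Fin m₂) (Fin n₂) ℍ[ℝ]) (B₂ : Matrix (Fin r₂) (Fin s₂) ℍ[ℝ])
    (C₂ : Matrix (Fin m₂) (Fin r₂) ℍ[ℝ]) (D₂ : Matrix (Fin n₂) (Fin s₂) ℍ[ℝ])
    (A₃ : Matrix (Fin m₃) (Fin n₃) ℍ[ℝ]) (B₃ : Matrix (Fin r₃) (Fin s₃) ℍ[ℝ])
    (C₃ : Matrix (Fin m₃) (Fin r₃) ℍ[ℝ]) (D₃ : Matrix (Fin n₃) (Fin s₃) ℍ[ℝ])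
    (A₄ : Matrix (Fin m₄) (Fin n₄) ℍ[ℝ]) (B₄ : Matrix (Fin r₄) (Fin s₄) ℍ[ℝ])
    (C₄ : Matrix (Fin m₄) (Fin r₄) ℍ[ℝ]) (D₄ : Matrix (Fin n₄) (Fin s₄) ℍ[ℝ])
    (E₁ : Matrix (Fin p) (Fin n₁) ℍ[ℝ]) (F₁ : Matrix (Fin r₁) (Fin q) ℍ[ℝ])
    (E₂ : Matrix (Fin p) (Fin n₂) ℍ[ℝ]) (F₂ : Matrix (Fin r₂) (Fin q) ℍ[ℝ])
    (E₃ : Matrix (Fin p) (Fin n₃) ℍ[ℝ]) (F₃ : Matrix (Fin r₃) (Fin q) ℍ[ℝ])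
    (E₄ : Matrix (Fin p) (Fin n₄) ℍ[ℝ]) (F₄ : Matrix (Fin r₄) (Fin q) ℍ[ℝ])
    (Cc : Matrix (Fin p) (Fin q) ℍ[ℝ])
    (h₂ : A₂ * D₂ = C₂ * B₂) (h₃ : A₃ * D₃ = C₃ * B₃) (h₄ : A₄ * D₄ = C₄ * B₄)
    (hA₁ : rproj A₁ * C₁ = 0) (hA₂ : rproj A₂ * C₂ = 0)
    (hA₃ : rproj A₃ * C₃ = 0) (hA₄ : rproj A₄ * C₄ = 0)
    (hB₁ : D₁ * lproj B₁ = 0) (hB₂ : D₂ * lproj B₂ = 0)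
    (hB₃ : D₃ * lproj B₃ = 0) (hB₄ : D₄ * lproj B₄ = 0) :
    let A₁₁ := E₁ * lproj A₁
    let A₂₂ := E₂ * lproj A₂
    let A₃₃ := E₃ * lproj A₃
    let A₄₄ := E₄ * lproj A₄
    let B₁₁ := rproj B₁ * F₁
    let B₂₂ := rproj B₂ * F₂
    let B₃₃ := rproj B₃ * F₃
    let B₄₄ := rproj B₄ * F₄
    let T₁ := Cc - E₁ * dg A₁ * C₁ - D₁ * dg B₁ * F₁
        - (E₂ * (dg A₂ * C₂ + lproj A₂ * D₂ * dg B₂) * F₂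
         + E₃ * (dg A₃ * C₃ + lproj A₃ * D₃ * dg B₃) * F₃
         + E₄ * (dg A₄ * C₄ + lproj A₄ * D₄ * dg B₄) * F₄)
    ((∃ (U : Matrix (Fin n₁) (Fin q) ℍ[ℝ]) (V : Matrix (Fin p) (Fin r₁) ℍ[ℝ])
        (X : Matrix (Fin n₂) (Fin r₂) ℍ[ℝ]) (Y : Matrix (Fin n₃) (Fin r₃) ℍ[ℝ])
        (Z : Matrix (Fin n₄) (Fin r₄) ℍ[ℝ]),
        A₁ * U = C₁ ∧ V * B₁ = D₁ ∧
        A₂ * X = C₂ ∧ X * B₂ = D₂ ∧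
        A₃ * Y = C₃ ∧ Y * B₃ = D₃ ∧
        A₄ * Z = C₄ ∧ Z * B₄ = D₄ ∧
        E₁ * U + V * F₁ + E₂ * X * F₂ + E₃ * Y * F₃ + E₄ * Z * F₄ = Cc) ↔
      (∃ (S₁ : Matrix (Fin n₁) (Fin q) ℍ[ℝ]) (S₂ : Matrix (Fin p) (Fin r₁) ℍ[ℝ])
        (U₁ : Matrix (Fin n₂) (Fin r₂) ℍ[ℝ]) (U₂ : Matrix (Fin n₃) (Fin r₃) ℍ[ℝ])
        (U₃ : Matrix (Fin n₄) (Fin r₄) ℍ[ℝ]),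
        A₁₁ * S₁ + S₂ * B₁₁ + A₂₂ * U₁ * B₂₂ + A₃₃ * U₂ * B₃₃ + A₄₄ * U₃ * B₄₄ = T₁)) := by
  intro A₁₁ A₂₂ A₃₃ A₄₄ B₁₁ B₂₂ B₃₃ B₄₄ T₁
  have key : ∀ (S₁ : Matrix (Fin n₁) (Fin q) ℍ[ℝ]) (S₂ : Matrix (Fin p) (Fin r₁) ℍ[ℝ])
      (U₁ : Matrix (Fin n₂) (Fin r₂) ℍ[ℝ]) (U₂ : Matrix (Fin n₃) (Fin r₃) ℍ[ℝ])
      (U₃ : Matrix (Fin n₄) (Fin r₄) ℍ[ℝ]),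
      A₁₁ * S₁ + S₂ * B₁₁ + A₂₂ * U₁ * B₂₂ + A₃₃ * U₂ * B₃₃ + A₄₄ * U₃ * B₄₄ = T₁ ↔
      E₁ * (dg A₁ * C₁ + lproj A₁ * S₁) + (D₁ * dg B₁ + S₂ * rproj B₁) * F₁
        + E₂ * (dg A₂ * C₂ + lproj A₂ * D₂ * dg B₂ + lproj A₂ * U₁ * rproj B₂) * F₂
        + E₃ * (dg A₃ * C₃ + lproj A₃ * D₃ * dg B₃ + lproj A₃ * U₂ * rproj B₃) * F₃
        + E₄ * (dg A₄ * C₄ + lproj A₄ * D₄ * dg B₄ + lproj A₄ * U₃ * rproj B₄) * F₄ = Cc := by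
    intro S₁ S₂ U₁ U₂ U₃
    simp only [A₁₁, A₂₂, A₃₃, A₄₄, B₁₁, B₂₂, B₃₃, B₄₄, T₁, Matrix.mul_add, Matrix.add_mul,
      Matrix.mul_assoc]
    rw [← sub_eq_zero, ← sub_eq_zero (b := Cc)]
    refine Eq.congr ?_ rfl
    abel
  constructor
  · rintro ⟨U, V, X, Y, Z, hU, hV, hX, hX', hY, hY', hZ, hZ', h⟩
    refine ⟨U, V, X, Y, Z, (key U V X Y Z).2 ?_⟩
    rw [← eq_add_lproj_mul hU, ← eq_add_mul_rproj hV, ← eq_add_lproj_mul_rproj hX hX',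
      ← eq_add_lproj_mul_rproj hY hY', ← eq_add_lproj_mul_rproj hZ hZ', h]
  · rintro ⟨S₁, S₂, U₁, U₂, U₃, h⟩
    exact ⟨_, _, _, _, _, mul_left_solution hA₁ S₁, mul_right_solution hB₁ S₂,
      mul_left_common_solution D₂ hA₂ U₁, mul_right_common_solution h₂ hB₂ U₁,
      mul_left_common_solution D₃ hA₃ U₂, mul_right_common_solution h₃ hB₃ U₂,
      mul_left_common_solution D₄ hA₄ U₃, mul_right_common_solution h₄ hB₄ U₃,
      (key S₁ S₂ U₁ U₂ U₃).1 h⟩
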